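/- arXiv:1908.11579 — 2 statements merged into one kernel-verified Lean document; each statement's English description precedes it below -/
import Mathlib

section
/- (Integrated global relation on the half line) Let T > 0 and let u : [0,∞) × [0,T] → ℂ be continuous, twice continuously differentiable in x and once in t on (0,∞) × (0,T), and satisfy the heat equation u_t = u_xx there. Assume that for each t the functions x ↦ u(x,t), x ↦ u_x(x,t), x ↦ u_xx(x,t) and x ↦ u_t(x,t) are integrable on (0,∞), that u(x,t) → 0 and u_x(x,t) → 0 as x → ∞ for each t, and that x ↦ u_t(x,t) is dominated, locally uniformly in t, by a fixed integrable function on (0,∞). Set u₀(x) = u(x,0), g(t) = u(0,t) and r(t) = u_x(0,t), and assume g and r are continuous on [0,T]. Then for every λ ∈ ℂ with Im λ ≤ 0 and every t ∈ [0,T]: e^{λ²t} û(λ,t) = û₀(λ) − ∫₀ᵗ e^{λ²τ} r(τ) dτ − iλ ∫₀ᵗ e^{λ²τ} g(τ) dτ. -/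
open MeasureTheory Filter

/-- The half-line Fourier transform `f̂(λ) = ∫₀^∞ e^{-iλx} f(x) dx`. -/
noncomputable def halfFourier (f : ℝ → ℂ) (l : ℂ) : ℂ :=
  ∫ x in Set.Ioi (0:ℝ), Complex.exp (-Complex.I * l * (x : ℂ)) * f x

/-- Mean value inequality on a closed interval, with differentiability only in the interior. -/
lemma norm_sub_le_of_hasDerivAt_Ioo {f f' : ℝ → ℂ} {a b C : ℝ} (hf : ContinuousOn f (Set.Icc a b))
    (hf' : ∀ t ∈ Set.Ioo a b, HasDerivAt f (f' t) t) (hC : ∀ t ∈ Set.Ioo a b, ‖f' t‖ ≤ C)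
    {s t : ℝ} (hs : s ∈ Set.Ioo a b) (ht : t ∈ Set.Icc a b) :
    ‖f t - f s‖ ≤ C * |t - s| := by
  have hcl : closure (Set.Ioo a b) = Set.Icc a b := closure_Ioo (hs.1.trans hs.2).ne
  refine le_on_closure (s := Set.Ioo a b) (f := fun t => ‖f t - f s‖)
    (g := fun t => C * |t - s|) (fun t ht => ?_) ?_ (by fun_prop) (hcl ▸ ht)
  · exact (convex_Ioo a b).norm_image_sub_le_of_norm_hasDerivWithin_le
      (fun x hx => (hf' x hx).hasDerivWithinAt) hC hs ht
  · rw [hcl]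
    exact (hf.sub continuousOn_const).norm

lemma norm_exp_neg_I_mul_le_one {l : ℂ} (hl : l.im ≤ 0) {x : ℝ} (hx : 0 ≤ x) :
    ‖Complex.exp (-Complex.I * l * (x : ℂ))‖ ≤ 1 := by
  rw [Complex.norm_exp, Real.exp_le_one_iff]
  simpa using mul_nonpos_of_nonpos_of_nonneg hl hx

lemma MeasureTheory.IntegrableOn.exp_neg_I_mul {l : ℂ} (hl : l.im ≤ 0) {f : ℝ → ℂ}
    (hf : IntegrableOn f (Set.Ioi 0)) :
    IntegrableOn (fun x : ℝ => Complex.exp (-Complex.I * l * (x : ℂ)) * f x) (Set.Ioi 0) := by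
  refine Integrable.bdd_mul (c := 1) hf (by fun_prop) ?_
  filter_upwards [ae_restrict_mem measurableSet_Ioi] with x hx
  exact norm_exp_neg_I_mul_le_one hl hx.le

/-- Two integrations by parts for the half-line Fourier transform. -/
lemma halfFourier_second_deriv {l : ℂ} (hl : l.im ≤ 0) {f f' f'' : ℝ → ℂ}
    (hf_cont : ContinuousWithinAt f (Set.Ici 0) 0)
    (hf'_cont : ContinuousWithinAt f' (Set.Ici 0) 0)
    (hf : ∀ x ∈ Set.Ioi (0:ℝ), HasDerivAt f (f' x) x)
    (hf' : ∀ x ∈ Set.Ioi (0:ℝ), HasDerivAt f' (f'' x) x)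
    (hf_int : IntegrableOn f (Set.Ioi 0)) (hf''_int : IntegrableOn f'' (Set.Ioi 0))
    (hf_lim : Tendsto f atTop (nhds 0)) (hf'_lim : Tendsto f' atTop (nhds 0)) :
    halfFourier f'' l = -f' 0 - Complex.I * l * f 0 - l ^ 2 * halfFourier f l := by
  have hI := Complex.I_sq
  have key : ∫ x in Set.Ioi (0:ℝ), (Complex.exp (-Complex.I * l * (x : ℂ)) * f'' x
      + l ^ 2 * (Complex.exp (-Complex.I * l * (x : ℂ)) * f x))
      = 0 - Complex.exp (-Complex.I * l * ((0:ℝ) : ℂ)) * (f' 0 + Complex.I * l * f 0) := by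
    refine integral_Ioi_of_hasDerivAt_of_tendsto
      (f := fun x : ℝ => Complex.exp (-Complex.I * l * (x : ℂ)) * (f' x + Complex.I * l * f x))
      ?_ (fun x hx => ?_)
      ((hf''_int.exp_neg_I_mul hl).add ((hf_int.exp_neg_I_mul hl).const_mul _)) ?_
    · exact ContinuousWithinAt.mul (by fun_prop)
        (hf'_cont.add (continuousWithinAt_const.mul hf_cont))
    · have he : HasDerivAt (fun x : ℝ => Complex.exp (-Complex.I * l * (x : ℂ)))
          (Complex.exp (-Complex.I * l * (x : ℂ)) * (-Complex.I * l * 1)) x :=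
        ((Complex.ofRealCLM.hasDerivAt (x := x)).const_mul (-Complex.I * l)).cexp
      refine (he.mul ((hf' x hx).add ((hf x hx).const_mul (Complex.I * l)))).congr_deriv ?_
      simp only [Pi.add_apply]
      linear_combination (-l ^ 2 * Complex.exp (-Complex.I * l * (x : ℂ)) * f x) * hI
    · have hz : Tendsto (fun x => f' x + Complex.I * l * f x) atTop (nhds 0) := by
        simpa using hf'_lim.add (hf_lim.const_mul (Complex.I * l))
      refine squeeze_zero_norm' ?_ (by simpa using hz.norm)
      filter_upwards [eventually_ge_atTop 0] with x hx
      rw [norm_mul]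
      exact mul_le_of_le_one_left (norm_nonneg _) (norm_exp_neg_I_mul_le_one hl hx)
  rw [integral_add (hf''_int.exp_neg_I_mul hl) ((hf_int.exp_neg_I_mul hl).const_mul _),
    integral_const_mul] at key
  simp only [Complex.ofReal_zero, mul_zero, Complex.exp_zero, one_mul] at key
  unfold halfFourier
  linear_combination key

/-- **Integrated global relation on the half line.**
For a classical solution of the heat equation on the half line with the stated
integrability, decay and domination assumptions, and with boundary traces
`g(t) = u(0,t)` and `r(t) = u_x(0,t)` continuous on `[0,T]`, one has
`e^{λ²t} û(λ,t) = û₀(λ) - ∫₀ᵗ e^{λ²τ} r(τ) dτ - iλ ∫₀ᵗ e^{λ²τ} g(τ) dτ`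
for every `λ` with `Im λ ≤ 0` and every `t ∈ [0,T]`. -/
theorem halfline_global_relation_integrated (T : ℝ) (hT : 0 < T)
    (u ux uxx ut : ℝ → ℝ → ℂ) (g r : ℝ → ℂ)
    (hu_cont : ContinuousOn (fun p : ℝ × ℝ => u p.1 p.2) (Set.Ici 0 ×ˢ Set.Icc 0 T))
    (hux : ∀ t ∈ Set.Ioo (0:ℝ) T, ∀ x ∈ Set.Ioi (0:ℝ),
      HasDerivAt (fun y => u y t) (ux x t) x)
    (huxx : ∀ t ∈ Set.Ioo (0:ℝ) T, ∀ x ∈ Set.Ioi (0:ℝ),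
      HasDerivAt (fun y => ux y t) (uxx x t) x)
    (hut : ∀ t ∈ Set.Ioo (0:ℝ) T, ∀ x ∈ Set.Ioi (0:ℝ),
      HasDerivAt (fun s => u x s) (ut x t) t)
    (hheat : ∀ t ∈ Set.Ioo (0:ℝ) T, ∀ x ∈ Set.Ioi (0:ℝ), ut x t = uxx x t)
    (hu_int : ∀ t ∈ Set.Icc (0:ℝ) T, IntegrableOn (fun x => u x t) (Set.Ioi 0))
    (hux_int : ∀ t ∈ Set.Ioo (0:ℝ) T, IntegrableOn (fun x => ux x t) (Set.Ioi 0))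
    (huxx_int : ∀ t ∈ Set.Ioo (0:ℝ) T, IntegrableOn (fun x => uxx x t) (Set.Ioi 0))
    (hut_int : ∀ t ∈ Set.Ioo (0:ℝ) T, IntegrableOn (fun x => ut x t) (Set.Ioi 0))
    (hu_decay : ∀ t ∈ Set.Ioo (0:ℝ) T, Tendsto (fun x => u x t) atTop (nhds 0))
    (hux_decay : ∀ t ∈ Set.Ioo (0:ℝ) T, Tendsto (fun x => ux x t) atTop (nhds 0))
    (hux_trace : ∀ t ∈ Set.Ioo (0:ℝ) T, ContinuousOn (fun x => ux x t) (Set.Ici 0))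
    (hdom : ∃ φ : ℝ → ℝ, IntegrableOn φ (Set.Ioi 0) ∧
      ∀ t₀ ∈ Set.Ioo (0:ℝ) T, ∀ᶠ t in nhdsWithin t₀ (Set.Ioo 0 T),
        ∀ x ∈ Set.Ioi (0:ℝ), ‖ut x t‖ ≤ φ x)
    (hgdef : ∀ t ∈ Set.Icc (0:ℝ) T, g t = u 0 t)
    (hrdef : ∀ t ∈ Set.Ioo (0:ℝ) T, r t = ux 0 t)
    (hg_cont : ContinuousOn g (Set.Icc 0 T))
    (hr_cont : ContinuousOn r (Set.Icc 0 T)) :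
    ∀ l : ℂ, l.im ≤ 0 → ∀ t ∈ Set.Icc (0:ℝ) T,
      Complex.exp (l ^ 2 * (t : ℂ)) * halfFourier (fun x => u x t) l
        = halfFourier (fun x => u x 0) l
          - (∫ τ in (0:ℝ)..t, Complex.exp (l ^ 2 * (τ : ℂ)) * r τ)
          - Complex.I * l * ∫ τ in (0:ℝ)..t, Complex.exp (l ^ 2 * (τ : ℂ)) * g τ := by
  intro l hl t ht
  obtain ⟨φ, hφ, hdom⟩ := hdom
  have hbound : ∀ s ∈ Set.Ioo (0:ℝ) T, ∀ x ∈ Set.Ioi (0:ℝ), ‖ut x s‖ ≤ φ x :=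
    fun s hs => (hdom s hs).self_of_nhdsWithin hs
  have hu_t : ∀ x ∈ Set.Ici (0:ℝ), ContinuousOn (fun s => u x s) (Set.Icc 0 T) := fun x hx =>
    hu_cont.comp (f := fun s : ℝ => (x, s)) (by fun_prop) fun s hs => ⟨hx, hs⟩
  have hu_x : ∀ s ∈ Set.Icc (0:ℝ) T, ContinuousOn (fun x => u x s) (Set.Ici 0) := fun s hs =>
    hu_cont.comp (f := fun x : ℝ => (x, s)) (by fun_prop) fun x hx => ⟨hx, hs⟩
  have hmid : T / 2 ∈ Set.Ioo (0:ℝ) T := ⟨by linarith, by linarith⟩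
  have hF_cont : ContinuousOn (fun s => halfFourier (fun x => u x s) l) (Set.Icc 0 T) := by
    refine continuousOn_of_dominated (bound := fun x => ‖u x (T / 2)‖ + φ x * T)
      (fun s hs => ((hu_int s hs).exp_neg_I_mul hl).aestronglyMeasurable) (fun s hs => ?_)
      ((hu_int _ (Set.Ioo_subset_Icc_self hmid)).norm.add (hφ.mul_const T)) ?_
    · filter_upwards [ae_restrict_mem measurableSet_Ioi] with x hx
      have hmv := norm_sub_le_of_hasDerivAt_Ioo (hu_t x (Set.Ioi_subset_Ici_self hx))
        (fun s hs => hut s hs x hx) (fun s hs => hbound s hs x hx) hmid hs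
      have hφx : 0 ≤ φ x := (norm_nonneg _).trans (hbound _ hmid x hx)
      have hsT : |s - T / 2| ≤ T := abs_le.2 ⟨by linarith [hs.1], by linarith [hs.2]⟩
      rw [norm_mul]
      calc _ ≤ ‖u x s‖ :=
            mul_le_of_le_one_left (norm_nonneg _) (norm_exp_neg_I_mul_le_one hl hx.le)
        _ ≤ ‖u x (T / 2)‖ + ‖u x s - u x (T / 2)‖ := norm_le_norm_add_norm_sub' _ _
        _ ≤ _ := by gcongr; exact hmv.trans (mul_le_mul_of_nonneg_left hsT hφx)
    · filter_upwards [ae_restrict_mem measurableSet_Ioi] with x hx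
      exact continuousOn_const.mul (hu_t x (Set.Ioi_subset_Ici_self hx))
  have hF_deriv : ∀ s ∈ Set.Ioo (0:ℝ) T, HasDerivAt (fun s => halfFourier (fun x => u x s) l)
      (halfFourier (fun x => ut x s) l) s := by
    intro s hs
    refine (hasDerivAt_integral_of_dominated_loc_of_deriv_le (bound := φ)
      (μ := volume.restrict (Set.Ioi (0:ℝ)))
      (F := fun s x => Complex.exp (-Complex.I * l * (x : ℂ)) * u x s)
      (F' := fun s x => Complex.exp (-Complex.I * l * (x : ℂ)) * ut x s)
      (Ioo_mem_nhds hs.1 hs.2) ?_ ((hu_int s (Set.Ioo_subset_Icc_self hs)).exp_neg_I_mul hl)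
      ((hut_int s hs).exp_neg_I_mul hl).aestronglyMeasurable ?_ hφ ?_).2
    · filter_upwards [Ioo_mem_nhds hs.1 hs.2] with s hs
      exact ((hu_int s (Set.Ioo_subset_Icc_self hs)).exp_neg_I_mul hl).aestronglyMeasurable
    · filter_upwards [ae_restrict_mem measurableSet_Ioi] with x hx s hs
      rw [norm_mul]
      exact (mul_le_of_le_one_left (norm_nonneg _) (norm_exp_neg_I_mul_le_one hl hx.le)).trans
        (hbound s hs x hx)
    · filter_upwards [ae_restrict_mem measurableSet_Ioi] with x hx s hs
      exact (hut s hs x hx).const_mul _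
  have hF_eq : ∀ s ∈ Set.Ioo (0:ℝ) T, halfFourier (fun x => ut x s) l
      = -r s - Complex.I * l * g s - l ^ 2 * halfFourier (fun x => u x s) l := by
    intro s hs
    have hs' := Set.Ioo_subset_Icc_self hs
    rw [hrdef s hs, hgdef s hs', ← halfFourier_second_deriv hl
      (hu_x s hs' 0 Set.self_mem_Ici) (hux_trace s hs 0 Set.self_mem_Ici) (hux s hs) (huxx s hs)
      (hu_int s hs') (huxx_int s hs) (hu_decay s hs) (hux_decay s hs)]
    exact setIntegral_congr_fun measurableSet_Ioi fun x hx => by simp only [hheat s hs x hx]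
  have hsub : Set.Icc 0 t ⊆ Set.Icc 0 T := Set.Icc_subset_Icc_right ht.2
  have hint : ∀ h : ℝ → ℂ, ContinuousOn h (Set.Icc 0 T) →
      IntervalIntegrable (fun τ => Complex.exp (l ^ 2 * (τ : ℂ)) * h τ) volume 0 t := fun h hh =>
    (ContinuousOn.mul (by fun_prop) (hh.mono hsub)).intervalIntegrable_of_Icc ht.1
  have hr_neg : IntervalIntegrable
      (fun τ : ℝ => -(Complex.exp (l ^ 2 * (τ : ℂ)) * r τ)) volume 0 t := (hint r hr_cont).neg
  have hftc := intervalIntegral.integral_eq_sub_of_hasDerivAt_of_le ht.1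
    (f := fun s : ℝ => Complex.exp (l ^ 2 * (s : ℂ)) * halfFourier (fun x => u x s) l)
    (f' := fun s : ℝ => -(Complex.exp (l ^ 2 * (s : ℂ)) * r s)
      - Complex.I * l * (Complex.exp (l ^ 2 * (s : ℂ)) * g s))
    (ContinuousOn.mul (by fun_prop) (hF_cont.mono hsub))
    (fun s hs => by
      have hs' : s ∈ Set.Ioo (0:ℝ) T := ⟨hs.1, hs.2.trans_le ht.2⟩
      have he : HasDerivAt (fun s : ℝ => Complex.exp (l ^ 2 * (s : ℂ)))
          (Complex.exp (l ^ 2 * (s : ℂ)) * (l ^ 2 * 1)) s :=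
        ((Complex.ofRealCLM.hasDerivAt (x := s)).const_mul (l ^ 2)).cexp
      refine (he.mul (hF_deriv s hs')).congr_deriv ?_
      rw [hF_eq s hs']
      ring)
    (hr_neg.sub ((hint g hg_cont).const_mul _))
  rw [intervalIntegral.integral_sub hr_neg ((hint g hg_cont).const_mul _),
    intervalIntegral.integral_neg, intervalIntegral.integral_const_mul] at hftc
  simp only [Complex.ofReal_zero, mul_zero, Complex.exp_zero, one_mul] at hftc
  linear_combination -hftc
end

section
/- (Lack of null controllability on the half line, contrapositive form for classical solutions) Let T > 0 and let u : [0,∞) × [0,T] → ℂ be continuous, twice continuously differentiable in x and once in t on (0,∞) × (0,T), and satisfy the heat equation u_t = u_xx there. Assume: for each t the functions x ↦ u(x,t), x ↦ u_x(x,t), x ↦ u_xx(x,t) and x ↦ u_t(x,t) are integrable on (0,∞); u(x,t) → 0 and u_x(x,t) → 0 as x → ∞ for each t; x ↦ u_t(x,t) is dominated, locally uniformly in t, by a fixed integrable function on (0,∞); and the boundary traces g(t) = u(0,t) and r(t) = u_x(0,t) are continuous on [0,T]. If u(x,T) = 0 for all x ≥ 0, then u(x,0) = 0 for all x ≥ 0.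 In particular, no nonzero integrable initial datum can be steered to zero at time T by any boundary control within this class of solutions. -/
open MeasureTheory Filter

/-- The finite Laplace transform of an integrable function is entire. -/
theorem differentiable_finiteLaplace {T : ℝ} {h : ℝ → ℂ} (hh : IntegrableOn h (Set.Ioc 0 T)) :
    Differentiable ℂ fun w : ℂ => ∫ t in Set.Ioc 0 T, Complex.exp (w * (t : ℂ)) * h t := by
  intro w
  have hmeas (f : ℝ → ℂ) (hf : Continuous f) :
      AEStronglyMeasurable (fun t => f t * h t) (volume.restrict (Set.Ioc 0 T)) :=
    hf.aestronglyMeasurable.mul hh.aestronglyMeasurable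
  have hexp {z : ℂ} {K t : ℝ} (hz : ‖z‖ ≤ K) (ht : t ∈ Set.Ioc 0 T) :
      ‖Complex.exp (z * (t : ℂ))‖ ≤ Real.exp (K * T) := by
    rw [Complex.norm_exp, Real.exp_le_exp, Complex.re_mul_ofReal]
    have := (Complex.re_le_norm z).trans hz
    have := (norm_nonneg z).trans hz
    nlinarith [ht.1, ht.2, mul_le_mul_of_nonneg_right (Complex.re_le_norm z) ht.1.le]
  refine (hasDerivAt_integral_of_dominated_loc_of_deriv_le (𝕜 := ℂ)
    (F' := fun z t => Complex.exp (z * (t : ℂ)) * (t : ℂ) * h t)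
    (bound := fun t => Real.exp ((‖w‖ + 1) * T) * T * ‖h t‖)
    (Metric.ball_mem_nhds w one_pos) ?_ ?_ ?_ ?_ ?_ ?_).2.differentiableAt
  · exact Eventually.of_forall fun z => hmeas _ (by fun_prop)
  · refine (hh.norm.const_mul (Real.exp (‖w‖ * T))).mono' (hmeas _ (by fun_prop)) ?_
    filter_upwards [ae_restrict_mem measurableSet_Ioc] with t ht
    rw [norm_mul]
    gcongr
    exact hexp le_rfl ht
  · exact hmeas _ (by fun_prop)
  · filter_upwards [ae_restrict_mem measurableSet_Ioc] with t ht z hz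
    have hz' : ‖z‖ ≤ ‖w‖ + 1 := by
      have := norm_sub_norm_le z w
      rw [mem_ball_iff_norm] at hz
      linarith
    rw [norm_mul, norm_mul, Complex.norm_real, Real.norm_of_nonneg ht.1.le]
    gcongr
    · exact ht.1.le
    · exact hexp hz' ht
    · exact ht.2
  · exact hh.norm.const_mul _
  · refine Eventually.of_forall fun t z _ => HasDerivAt.mul_const ?_ _
    simpa using ((hasDerivAt_id z).mul_const (t : ℂ)).cexp

/-- A finite Laplace transform of an integrable function that stays bounded along the positive
real axis vanishes identically. -/
theorem finiteLaplace_eq_zero_of_bounded {T : ℝ} {h : ℝ → ℂ} (hh : IntegrableOn h (Set.Ioc 0 T))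
    {C : ℝ} (hC : ∀ s : ℝ, 1 ≤ s → ‖∫ t in Set.Ioc 0 T, Complex.exp ((s : ℂ) * t) * h t‖ ≤ C)
    (w : ℂ) : ∫ t in Set.Ioc 0 T, Complex.exp (w * (t : ℂ)) * h t = 0 := by
  set A : ℂ → ℂ := fun w => ∫ t in Set.Ioc 0 T, Complex.exp (w * (t : ℂ)) * h t
  set M : ℝ := ∫ t in Set.Ioc 0 T, ‖h t‖ with hM
  have hdiff : Differentiable ℂ A := differentiable_finiteLaplace hh
  have hbound {K : ℝ} {z : ℂ} (hz : ∀ t ∈ Set.Ioc 0 T, z.re * t ≤ K) :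
      ‖A z‖ ≤ Real.exp K * M := by
    rw [hM, ← integral_const_mul]
    refine norm_integral_le_of_norm_le (hh.norm.const_mul _) ?_
    filter_upwards [ae_restrict_mem measurableSet_Ioc] with t ht
    rw [norm_mul, Complex.norm_exp, Complex.re_mul_ofReal]
    gcongr
    exact hz t ht
  have hleft {z : ℂ} (hz : z.re ≤ 0) : ‖A z‖ ≤ M := by
    simpa using hbound (K := 0) fun t ht => mul_nonpos_of_nonpos_of_nonneg hz ht.1.le
  have hright {z : ℂ} (hz : 0 ≤ z.re) : ‖A z‖ ≤ M := by
    refine PhragmenLindelof.right_half_plane_of_bounded_on_real hdiff.diffContOnCl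
      ⟨1, one_lt_two, T, ?_⟩ ?_ (fun x => hleft (by simp)) hz
    · refine Asymptotics.IsBigO.of_bound M (eventually_inf_principal.2 (Eventually.of_forall ?_))
      intro z hz
      rw [Real.rpow_one, Real.norm_of_nonneg (Real.exp_pos _).le, mul_comm M]
      refine hbound fun t ht => ?_
      have hz' : 0 < z.re := hz
      nlinarith [ht.1, ht.2, Complex.re_le_norm z]
    · exact isBoundedUnder_of_eventually_le ((eventually_ge_atTop 1).mono hC)
  have hbdd : Bornology.IsBounded (Set.range A) := by
    refine isBounded_iff_forall_norm_le.2 ⟨M, ?_⟩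
    rintro _ ⟨z, rfl⟩
    exact (le_total z.re 0).elim hleft hright
  have hlim : Tendsto (fun s : ℝ => A (-s : ℂ)) atTop (nhds 0) := by
    have := tendsto_integral_filter_of_dominated_convergence (l := atTop)
      (μ := volume.restrict (Set.Ioc 0 T)) (F := fun (s t : ℝ) => Complex.exp (-s * t : ℂ) * h t)
      (f := fun _ => (0 : ℂ)) (fun t => ‖h t‖) ?_ ?_ hh.norm ?_
    · simpa only [integral_zero] using this
    · exact Eventually.of_forall fun s => (by fun_prop : Continuous fun t : ℝ =>
        Complex.exp (-s * t : ℂ)).aestronglyMeasurable.mul hh.aestronglyMeasurable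
    · filter_upwards [eventually_ge_atTop 0] with s hs
      filter_upwards [ae_restrict_mem measurableSet_Ioc] with t ht
      rw [norm_mul, Complex.norm_exp, Complex.re_mul_ofReal]
      refine mul_le_of_le_one_left (norm_nonneg _) (Real.exp_le_one_iff.2 ?_)
      simpa using mul_nonneg hs ht.1.le
    · filter_upwards [ae_restrict_mem measurableSet_Ioc] with t ht
      rw [← zero_mul (h t)]
      refine Tendsto.mul_const _ (tendsto_zero_iff_norm_tendsto_zero.2 ?_)
      simp only [Complex.norm_exp, Complex.re_mul_ofReal, Complex.neg_re, Complex.ofReal_re]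
      exact Real.tendsto_exp_atBot.comp
        ((tendsto_neg_atTop_atBot).atBot_mul_const ht.1)
  have hconst : (fun s : ℝ => A (-s : ℂ)) = fun _ => A w :=
    funext fun s => hdiff.apply_eq_apply_of_bounded hbdd _ _
  rw [hconst] at hlim
  exact tendsto_nhds_unique tendsto_const_nhds hlim

theorem norm_exp_neg_I_mul (l x : ℝ) : ‖Complex.exp (-Complex.I * l * x)‖ = 1 := by
  simp [Complex.norm_exp]

theorem integrableOn_exp_neg_I_mul {f : ℝ → ℂ} (hf : IntegrableOn f (Set.Ioi 0)) (l : ℝ) :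
    IntegrableOn (fun x : ℝ => Complex.exp (-Complex.I * l * x) * f x) (Set.Ioi 0) := by
  refine Integrable.bdd_mul (c := 1) hf (by fun_prop) ?_
  exact Eventually.of_forall fun x => (norm_exp_neg_I_mul l x).le

theorem norm_halfFourier_le (f : ℝ → ℂ) (l : ℝ) :
    ‖halfFourier f l‖ ≤ ∫ x in Set.Ioi (0 : ℝ), ‖f x‖ := by
  refine (norm_integral_le_integral_norm _).trans_eq ?_
  simp only [norm_mul, norm_exp_neg_I_mul, one_mul]

/-- An integrable function on the half line whose half-line Fourier transform vanishes on the real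
axis vanishes at its points of continuity. -/
theorem eq_zero_of_halfFourier_eq_zero {f : ℝ → ℂ} (hf : IntegrableOn f (Set.Ioi 0))
    (hzero : ∀ l : ℝ, halfFourier f l = 0) {x : ℝ} (hx : 0 < x) (hcont : ContinuousAt f x) :
    f x = 0 := by
  set F : ℝ → ℂ := (Set.Ioi 0).indicator f with hF
  have hFx : F =ᶠ[nhds x] f := by
    filter_upwards [Ioi_mem_nhds hx] with y hy
    exact Set.indicator_of_mem hy f
  have hFourier : FourierTransform.fourier F = 0 := by
    ext w
    rw [Real.fourier_real_eq_integral_exp_smul, Pi.zero_apply, ← hzero (2 * Real.pi * w),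
      halfFourier, ← integral_indicator measurableSet_Ioi]
    congr 1
    ext y
    by_cases hy : y ∈ Set.Ioi (0 : ℝ)
    · simp only [hF, Set.indicator_of_mem hy, smul_eq_mul]
      congr 2
      push_cast
      ring
    · simp [hF, Set.indicator_of_notMem hy]
  have hinv := (hf.integrable_indicator measurableSet_Ioi).fourierInv_fourier_eq
    (by rw [hFourier]; exact integrable_zero _ _ _) (hcont.congr hFx.symm)
  rw [hFourier] at hinv
  rw [← show F x = f x from hFx.eq_of_nhds, hF, ← hinv, Real.fourierInv_eq]
  simp

/-- Integration by parts twice in the half-line Fourier transform of a second derivative. -/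
theorem integral_exp_mul_deriv_deriv {f f' f'' : ℝ → ℂ} (l : ℝ)
    (hf : ∀ x ∈ Set.Ioi (0 : ℝ), HasDerivAt f (f' x) x)
    (hf' : ∀ x ∈ Set.Ioi (0 : ℝ), HasDerivAt f' (f'' x) x)
    (hf_cont : ContinuousWithinAt f (Set.Ici 0) 0)
    (hf'_cont : ContinuousWithinAt f' (Set.Ici 0) 0)
    (hf_int : IntegrableOn f (Set.Ioi 0)) (hf''_int : IntegrableOn f'' (Set.Ioi 0))
    (hf_lim : Tendsto f atTop (nhds 0)) (hf'_lim : Tendsto f' atTop (nhds 0)) :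
    halfFourier f'' l = -(f' 0 + Complex.I * l * f 0) - (l : ℂ) ^ 2 * halfFourier f l := by
  have hexp (x : ℝ) : HasDerivAt (fun y : ℝ => Complex.exp (-Complex.I * l * y))
      (Complex.exp (-Complex.I * l * x) * (-Complex.I * l)) x := by
    simpa using (((hasDerivAt_id x).ofReal_comp).const_mul (-Complex.I * (l : ℂ))).cexp
  have h := integral_Ioi_of_hasDerivAt_of_tendsto (a := 0) (m := 0)
    (f := fun x : ℝ => Complex.exp (-Complex.I * l * x) * (f' x + Complex.I * l * f x))
    (f' := fun x : ℝ => Complex.exp (-Complex.I * l * x) * f'' x +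
      (l : ℂ) ^ 2 * (Complex.exp (-Complex.I * l * x) * f x)) ?_ ?_ ?_ ?_
  · rw [integral_add (integrableOn_exp_neg_I_mul hf''_int l)
      ((integrableOn_exp_neg_I_mul hf_int l).const_mul _), integral_const_mul] at h
    simp only [Complex.ofReal_zero, mul_zero, Complex.exp_zero, one_mul, zero_sub] at h
    rw [halfFourier, halfFourier, ← h]
    ring
  · exact (hexp 0).continuousAt.continuousWithinAt.mul
      (hf'_cont.add (continuousWithinAt_const.mul hf_cont))
  · intro x hx
    refine ((hexp x).mul ((hf' x hx).add
      ((hf x hx).const_mul (Complex.I * (l : ℂ))))).congr_deriv ?_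
    simp only [Pi.add_apply]
    linear_combination -(l : ℂ) ^ 2 * Complex.exp (-Complex.I * l * x) * f x * Complex.I_sq
  · exact (integrableOn_exp_neg_I_mul hf''_int l).add
      ((integrableOn_exp_neg_I_mul hf_int l).const_mul _)
  · have hlim : Tendsto (fun x => f' x + Complex.I * l * f x) atTop (nhds 0) := by
      simpa using hf'_lim.add (hf_lim.const_mul (Complex.I * (l : ℂ)))
    rw [tendsto_zero_iff_norm_tendsto_zero] at hlim ⊢
    simpa only [norm_mul, norm_exp_neg_I_mul, one_mul] using hlim

/-- The half-line Fourier transform of a time-dependent function is differentiable in time when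
the time derivative is dominated by an integrable function. -/
theorem hasDerivAt_halfFourier {u ut : ℝ → ℝ → ℂ} {T t l : ℝ} {φ : ℝ → ℝ}
    (ht : t ∈ Set.Ioo 0 T)
    (hut : ∀ t ∈ Set.Ioo (0 : ℝ) T, ∀ x ∈ Set.Ioi (0 : ℝ),
      HasDerivAt (fun s => u x s) (ut x t) t)
    (hu_int : ∀ t ∈ Set.Ioo (0 : ℝ) T, IntegrableOn (fun x => u x t) (Set.Ioi 0))
    (hut_int : IntegrableOn (fun x => ut x t) (Set.Ioi 0))
    (hφ : IntegrableOn φ (Set.Ioi 0))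
    (hdom : ∀ t ∈ Set.Ioo (0 : ℝ) T, ∀ x ∈ Set.Ioi (0 : ℝ), ‖ut x t‖ ≤ φ x) :
    HasDerivAt (fun s => halfFourier (fun x => u x s) l) (halfFourier (fun x => ut x t) l) t := by
  refine (hasDerivAt_integral_of_dominated_loc_of_deriv_le (𝕜 := ℝ)
    (F := fun s x => Complex.exp (-Complex.I * l * (x : ℂ)) * u x s)
    (F' := fun s x => Complex.exp (-Complex.I * l * (x : ℂ)) * ut x s)
    (bound := φ) (Ioo_mem_nhds ht.1 ht.2) ?_ ?_ ?_ ?_ hφ ?_).2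
  · filter_upwards [Ioo_mem_nhds ht.1 ht.2] with s hs
    exact (integrableOn_exp_neg_I_mul (hu_int s hs) l).aestronglyMeasurable
  · exact integrableOn_exp_neg_I_mul (hu_int t ht) l
  · exact (integrableOn_exp_neg_I_mul hut_int l).aestronglyMeasurable
  · filter_upwards [ae_restrict_mem measurableSet_Ioi] with x hx s hs
    rw [norm_mul, norm_exp_neg_I_mul, one_mul]
    exact hdom s hs x hx
  · filter_upwards [ae_restrict_mem measurableSet_Ioi] with x hx s hs
    exact (hut s hs x hx).const_mul _

/-- The half-line Fourier transform of a dominated family is continuous in time. -/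
theorem continuousOn_halfFourier {u : ℝ → ℝ → ℂ} {S : Set ℝ} {φ : ℝ → ℝ} (l : ℝ)
    (hu : ∀ x ∈ Set.Ioi (0 : ℝ), ContinuousOn (fun t => u x t) S)
    (hu_int : ∀ t ∈ S, IntegrableOn (fun x => u x t) (Set.Ioi 0))
    (hφ : IntegrableOn φ (Set.Ioi 0))
    (hdom : ∀ t ∈ S, ∀ x ∈ Set.Ioi (0 : ℝ), ‖u x t‖ ≤ φ x) :
    ContinuousOn (fun t => halfFourier (fun x => u x t) l) S := by
  intro t ht
  refine continuousWithinAt_of_dominated (bound := φ) ?_ ?_ hφ ?_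
  · filter_upwards [self_mem_nhdsWithin] with s hs
    exact (integrableOn_exp_neg_I_mul (hu_int s hs) l).aestronglyMeasurable
  · filter_upwards [self_mem_nhdsWithin] with s hs
    filter_upwards [ae_restrict_mem measurableSet_Ioi] with x hx
    rw [norm_mul, norm_exp_neg_I_mul, one_mul]
    exact hdom s hs x hx
  · filter_upwards [ae_restrict_mem measurableSet_Ioi] with x hx
    exact continuousWithinAt_const.mul (hu x hx t ht)

/-- A function vanishing at time `T` whose derivative on `(0, T)` is bounded by `K` is bounded
by `K * T` on `(0, T]`. -/
theorem norm_le_of_norm_deriv_le_of_final_eq_zero {f f' : ℝ → ℂ} {T K t : ℝ}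
    (hf : ContinuousOn f (Set.Icc 0 T)) (hf' : ∀ s ∈ Set.Ioo 0 T, HasDerivAt f (f' s) s)
    (hK : ∀ s ∈ Set.Ioo 0 T, ‖f' s‖ ≤ K) (hfT : f T = 0) (ht : t ∈ Set.Ioo 0 T) :
    ‖f t‖ ≤ K * T := by
  have hsub {s : ℝ} (hs : s ∈ Set.Ico t T) : s ∈ Set.Ioo 0 T := ⟨ht.1.trans_le hs.1, hs.2⟩
  have h := norm_image_sub_le_of_norm_deriv_right_le_segment
    (hf.mono (Set.Icc_subset_Icc_left ht.1.le))
    (fun s hs => (hf' s (hsub hs)).hasDerivWithinAt) (fun s hs => hK s (hsub hs)) T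
    (Set.right_mem_Icc.2 ht.2.le)
  rw [hfT, zero_sub, norm_neg] at h
  have := (norm_nonneg _).trans (hK t ht)
  nlinarith [ht.1]

/-- **Lack of null controllability on the half line (contrapositive form).**
For a classical solution of the heat equation on the half line, within the stated
class (integrability, decay, domination, continuous boundary traces), if the solution
vanishes identically at time `T` then the initial datum vanishes identically.  In
particular no nonzero integrable initial datum can be steered to zero at time `T`
by any boundary control within this class of solutions. -/
theorem lack_of_null_controllability_halfline (T : ℝ) (hT : 0 < T)
    (u ux uxx ut : ℝ → ℝ → ℂ) (g r : ℝ → ℂ)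
    (hu_cont : ContinuousOn (fun p : ℝ × ℝ => u p.1 p.2) (Set.Ici 0 ×ˢ Set.Icc 0 T))
    (hux : ∀ t ∈ Set.Ioo (0:ℝ) T, ∀ x ∈ Set.Ioi (0:ℝ),
      HasDerivAt (fun y => u y t) (ux x t) x)
    (huxx : ∀ t ∈ Set.Ioo (0:ℝ) T, ∀ x ∈ Set.Ioi (0:ℝ),
      HasDerivAt (fun y => ux y t) (uxx x t) x)
    (hut : ∀ t ∈ Set.Ioo (0:ℝ) T, ∀ x ∈ Set.Ioi (0:ℝ),
      HasDerivAt (fun s => u x s) (ut x t) t)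
    (hheat : ∀ t ∈ Set.Ioo (0:ℝ) T, ∀ x ∈ Set.Ioi (0:ℝ), ut x t = uxx x t)
    (hu_int : ∀ t ∈ Set.Icc (0:ℝ) T, IntegrableOn (fun x => u x t) (Set.Ioi 0))
    (hux_int : ∀ t ∈ Set.Ioo (0:ℝ) T, IntegrableOn (fun x => ux x t) (Set.Ioi 0))
    (huxx_int : ∀ t ∈ Set.Ioo (0:ℝ) T, IntegrableOn (fun x => uxx x t) (Set.Ioi 0))
    (hut_int : ∀ t ∈ Set.Ioo (0:ℝ) T, IntegrableOn (fun x => ut x t) (Set.Ioi 0))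
    (hu_decay : ∀ t ∈ Set.Ioo (0:ℝ) T, Tendsto (fun x => u x t) atTop (nhds 0))
    (hux_decay : ∀ t ∈ Set.Ioo (0:ℝ) T, Tendsto (fun x => ux x t) atTop (nhds 0))
    (hux_trace : ∀ t ∈ Set.Ioo (0:ℝ) T, ContinuousOn (fun x => ux x t) (Set.Ici 0))
    (hdom : ∃ φ : ℝ → ℝ, IntegrableOn φ (Set.Ioi 0) ∧
      ∀ t₀ ∈ Set.Ioo (0:ℝ) T, ∀ᶠ t in nhdsWithin t₀ (Set.Ioo 0 T),
        ∀ x ∈ Set.Ioi (0:ℝ), ‖ut x t‖ ≤ φ x)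
    (hgdef : ∀ t ∈ Set.Icc (0:ℝ) T, g t = u 0 t)
    (hrdef : ∀ t ∈ Set.Ioo (0:ℝ) T, r t = ux 0 t)
    (hg_cont : ContinuousOn g (Set.Icc 0 T))
    (hr_cont : ContinuousOn r (Set.Icc 0 T))
    (hfinal : ∀ x : ℝ, 0 ≤ x → u x T = 0) :
    ∀ x : ℝ, 0 ≤ x → u x 0 = 0 := by
  obtain ⟨φ, hφ, hφdom⟩ := hdom
  have hut_le : ∀ t ∈ Set.Ioo (0:ℝ) T, ∀ x ∈ Set.Ioi (0:ℝ), ‖ut x t‖ ≤ φ x :=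
    fun t ht => (hφdom t ht).self_of_nhdsWithin ht
  have hcont_t : ∀ x ∈ Set.Ici (0:ℝ), ContinuousOn (fun t => u x t) (Set.Icc 0 T) :=
    fun x hx => hu_cont.comp (f := fun t => (x, t)) (by fun_prop) fun t ht => ⟨hx, ht⟩
  have hcont_x : ∀ t ∈ Set.Icc (0:ℝ) T, ContinuousOn (fun x => u x t) (Set.Ici 0) :=
    fun t ht => hu_cont.comp (f := fun x => (x, t)) (by fun_prop) fun x hx => ⟨hx, ht⟩
  have h0 : (0:ℝ) ∈ Set.Icc 0 T := Set.left_mem_Icc.2 hT.le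
  have hu_le : ∀ t ∈ Set.Icc (0:ℝ) T, ∀ x ∈ Set.Ioi (0:ℝ), ‖u x t‖ ≤ φ x * T + ‖u x 0‖ := by
    intro t ht x hx
    have hmid : T / 2 ∈ Set.Ioo 0 T := ⟨by linarith, by linarith⟩
    have hφx : 0 ≤ φ x * T := mul_nonneg ((norm_nonneg _).trans (hut_le _ hmid x hx)) hT.le
    rcases ht.1.eq_or_lt with rfl | ht0
    · linarith
    rcases ht.2.eq_or_lt with rfl | htT
    · rw [hfinal x (le_of_lt hx), norm_zero]
      positivity
    · exact (norm_le_of_norm_deriv_le_of_final_eq_zero (hcont_t x (Set.mem_Ici_of_Ioi hx))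
        (fun s hs => hut s hs x hx) (fun s hs => hut_le s hs x hx) (hfinal x (le_of_lt hx))
        ⟨ht0, htT⟩).trans (le_add_of_nonneg_right (norm_nonneg _))
  have hr_int : IntegrableOn r (Set.Ioc 0 T) :=
    (hr_cont.integrableOn_Icc).mono_set Set.Ioc_subset_Icc_self
  have hg_int : IntegrableOn g (Set.Ioc 0 T) :=
    (hg_cont.integrableOn_Icc).mono_set Set.Ioc_subset_Icc_self
  have hexp_int {h : ℝ → ℂ} (hh : ContinuousOn h (Set.Icc 0 T)) (w : ℂ) :
      IntegrableOn (fun t : ℝ => Complex.exp (w * (t : ℂ)) * h t) (Set.Ioc 0 T) :=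
    (ContinuousOn.mul (by fun_prop) hh).integrableOn_Icc.mono_set Set.Ioc_subset_Icc_self
  set A : (ℝ → ℂ) → ℂ → ℂ :=
    fun h w => ∫ t in Set.Ioc 0 T, Complex.exp (w * (t : ℂ)) * h t
  have hrel (l : ℝ) : halfFourier (fun x => u x 0) l =
      A r ((l ^ 2 : ℝ) : ℂ) + Complex.I * l * A g ((l ^ 2 : ℝ) : ℂ) := by
    have hexp (t : ℝ) : HasDerivAt (fun s : ℝ => Complex.exp (((l ^ 2 : ℝ) : ℂ) * s))
        (Complex.exp (((l ^ 2 : ℝ) : ℂ) * t) * ((l ^ 2 : ℝ) : ℂ)) t := by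
      simpa only [id, Complex.ofReal_one, mul_one] using
        (((hasDerivAt_id t).ofReal_comp).const_mul ((l ^ 2 : ℝ) : ℂ)).cexp
    have hFTC := intervalIntegral.integral_eq_sub_of_hasDerivAt_of_le hT.le
      (f := fun t : ℝ => Complex.exp (((l ^ 2 : ℝ) : ℂ) * t) * halfFourier (fun x => u x t) l)
      (f' := fun t : ℝ => -(Complex.exp (((l ^ 2 : ℝ) : ℂ) * t) * r t +
        Complex.I * l * (Complex.exp (((l ^ 2 : ℝ) : ℂ) * t) * g t))) ?_ ?_ ?_
    · rw [intervalIntegral.integral_of_le hT.le, integral_neg,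
        integral_add (hexp_int hr_cont _) ((hexp_int hg_cont _).const_mul _),
        integral_const_mul] at hFTC
      have hfin : halfFourier (fun x => u x T) l = 0 := by
        refine (setIntegral_congr_fun measurableSet_Ioi fun x hx => ?_).trans (integral_zero _ _)
        simp [hfinal x (le_of_lt hx)]
      simp only [hfin, Complex.ofReal_zero, mul_zero, Complex.exp_zero, one_mul, zero_sub,
        neg_inj] at hFTC
      exact hFTC.symm
    · exact ContinuousOn.mul (by fun_prop) (continuousOn_halfFourier l
        (fun x hx => hcont_t x (Set.mem_Ici_of_Ioi hx)) hu_int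
        ((hφ.mul_const T).add (hu_int 0 h0).norm) hu_le)
    · intro t ht
      have ht' := Set.Ioo_subset_Icc_self ht
      have hder := hasDerivAt_halfFourier (l := l) ht hut
        (fun s hs => hu_int s (Set.Ioo_subset_Icc_self hs)) (hut_int t ht) hφ hut_le
      have hutt : halfFourier (fun x => ut x t) l = halfFourier (fun x => uxx x t) l :=
        setIntegral_congr_fun measurableSet_Ioi fun x hx => by simp only [hheat t ht x hx]
      rw [hutt, integral_exp_mul_deriv_deriv l (hux t ht) (huxx t ht)
        (hcont_x t ht' 0 Set.self_mem_Ici) (hux_trace t ht 0 Set.self_mem_Ici)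
        (hu_int t ht') (huxx_int t ht) (hu_decay t ht) (hux_decay t ht),
        ← hrdef t ht, ← hgdef t ht'] at hder
      refine ((hexp t).mul hder).congr_deriv ?_
      push_cast
      ring
    · rw [intervalIntegrable_iff_integrableOn_Ioc_of_le hT.le]
      exact ((hexp_int hr_cont _).add ((hexp_int hg_cont _).const_mul _)).neg
  set M : ℝ := ∫ x in Set.Ioi (0:ℝ), ‖u x 0‖
  have hle (l : ℝ) : ‖halfFourier (fun x => u x 0) l‖ ≤ M := norm_halfFourier_le _ l
  have hr_zero : ∀ w, A r w = 0 := by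
    refine finiteLaplace_eq_zero_of_bounded hr_int (C := M) fun s hs => ?_
    have hsq : √s ^ 2 = s := Real.sq_sqrt (by linarith)
    have hp := hrel (√s)
    have hm := hrel (-√s)
    rw [neg_sq, Complex.ofReal_neg] at hm
    rw [hsq] at hp hm
    have hsum : 2 * A r (s : ℂ) = halfFourier (fun x => u x 0) (√s : ℝ) +
        halfFourier (fun x => u x 0) (-√s : ℝ) := by
      rw [Complex.ofReal_neg, hp, hm]
      ring
    have h2 := (congrArg norm hsum).le.trans
      ((norm_add_le _ _).trans (add_le_add (hle _) (hle _)))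
    rw [norm_mul, Complex.norm_ofNat] at h2
    change ‖A r s‖ ≤ M
    linarith
  have hg_zero : ∀ w, A g w = 0 := by
    refine finiteLaplace_eq_zero_of_bounded hg_int (C := M) fun s hs => ?_
    have hsq : √s ^ 2 = s := Real.sq_sqrt (by linarith)
    have hp := hle (√s)
    rw [hrel, hsq, hr_zero, zero_add, norm_mul, norm_mul, Complex.norm_I, one_mul,
      Complex.norm_real, Real.norm_of_nonneg (Real.sqrt_nonneg s)] at hp
    exact (le_mul_of_one_le_left (norm_nonneg _) (Real.one_le_sqrt.2 hs)).trans hp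
  have hpos : Set.EqOn (fun x => u x 0) 0 (Set.Ioi 0) := fun x hx =>
    eq_zero_of_halfFourier_eq_zero (hu_int 0 h0)
      (fun l => by rw [hrel, hr_zero, hg_zero, mul_zero, add_zero]) hx
      ((hcont_x 0 h0).continuousAt (Ici_mem_nhds hx))
  have hclosed : Set.EqOn (fun x => u x 0) 0 (Set.Ici 0) :=
    hpos.of_subset_closure (hcont_x 0 h0) continuousOn_const Set.Ioi_subset_Ici_self
      (by rw [closure_Ioi])
  exact fun x hx => hclosed hx
end
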